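/- With PCF types T_PCF, intrinsically typed PCF terms PCF, untyped lambda terms LC, and the translation ⟦·⟧ : PCF Γ τ → LC (Σ τ', Γ τ') defined as before (variables to variables, app to app, abs to abs with reindexing, booleans and if to their Church encodings, zero/succ/pred to Church-numeral combinators, and Fix_τ t to app Y ⟦t⟧ with Y Curry's fixpoint combinator), the translation commutes with simultaneous substitution: for every typed substitution σ : ∀ u, Γ u → PCF Δ u and every t : PCF Γ τ, ⟦subst t σ⟧ = LC.subst ⟦t⟧ (fun ⟨u, x⟩ => ⟦σ u x⟧), where subst is typed simultaneous substitution of PCF terms and LC.subst is simultaneous substitution of untyped lambda terms. -/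

import Mathlib

/-! PCF types and intrinsically typed PCF terms, untyped lambda terms, and the translation
of PCF into the untyped lambda calculus via Church encodings. -/

/-- PCF types: `𝔹`, `ℕ` and arrow types. -/
inductive PTy : Type
  | bool : PTy
  | nat : PTy
  | arrow : PTy → PTy → PTy

/-- The extension `Γ ,, s` of a context `Γ : PTy → Type` by a fresh variable of type `s`. -/
def extCtx (Γ : PTy → Type) (s : PTy) : PTy → Type :=
  fun u => Γ u ⊕ PLift (s = u)

/-- Intrinsically typed PCF terms: variables, application, abstraction, the constants
`true`, `false`, `zero`, `succ`, `pred`, the fixpoint operators `Fix_τ`, and the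
conditionals `if_ι` for `ι ∈ {𝔹, ℕ}`. -/
inductive PCF : (PTy → Type) → PTy → Type 1
  | var {Γ : PTy → Type} {τ : PTy} : Γ τ → PCF Γ τ
  | app {Γ : PTy → Type} {s t : PTy} : PCF Γ (.arrow s t) → PCF Γ s → PCF Γ t
  | abs {Γ : PTy → Type} {s t : PTy} : PCF (extCtx Γ s) t → PCF Γ (.arrow s t)
  | tt {Γ : PTy → Type} : PCF Γ .bool
  | ff {Γ : PTy → Type} : PCF Γ .bool
  | zero {Γ : PTy → Type} : PCF Γ .nat
  | succ {Γ : PTy → Type} : PCF Γ (.arrow .nat .nat)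
  | pred {Γ : PTy → Type} : PCF Γ (.arrow .nat .nat)
  | fix {Γ : PTy → Type} (τ : PTy) : PCF Γ (.arrow τ τ) → PCF Γ τ
  | ite {Γ : PTy → Type} (ι : PTy) (hι : ι = .bool ∨ ι = .nat) :
      PCF Γ (.arrow .bool (.arrow ι (.arrow ι ι)))

namespace PCF

/-- Renaming of intrinsically typed PCF terms along `f : ∀ u, Γ u → Δ u`, commuting with
all constructors. -/
def rename : {Γ Δ : PTy → Type} → (∀ u, Γ u → Δ u) → {τ : PTy} →
    PCF Γ τ → PCF Δ τ
  | _, _, f, _, .var x => .var (f _ x)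
  | _, _, f, _, .app s t => .app (rename f s) (rename f t)
  | _, _, f, _, .abs t => .abs (rename (fun _ => Sum.map (f _) id) t)
  | _, _, _, _, .tt => .tt
  | _, _, _, _, .ff => .ff
  | _, _, _, _, .zero => .zero
  | _, _, _, _, .succ => .succ
  | _, _, _, _, .pred => .pred
  | _, _, f, _, .fix τ t => .fix τ (rename f t)
  | _, _, _, _, .ite ι hι => .ite ι hι

end PCF

/-- Untyped lambda calculus terms with variables in `X`. -/
inductive LC : Type → Type 1
  | var {X : Type} : X → LC X
  | app {X : Type} : LC X → LC X → LC X
  | abs {X : Type} : LC (Option X) → LC X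

namespace LC

/-- Renaming of untyped lambda terms along a function between variable types. -/
def rename : {X Y : Type} → (X → Y) → LC X → LC Y
  | _, _, f, .var x => .var (f x)
  | _, _, f, .app s t => .app (rename f s) (rename f t)
  | _, _, f, .abs t => .abs (rename (Option.map f) t)

end LC

/-- Weakening of a closed lambda term to an arbitrary variable type. -/
def wk {X : Type} (t : LC Empty) : LC X :=
  LC.rename Empty.elim t

/-- Church encoding of `true`: `λt.λf.t`. -/
def churchTrue : LC Empty := .abs (.abs (.var (some none)))

/-- Church encoding of `false`: `λt.λf.f`. -/
def churchFalse : LC Empty := .abs (.abs (.var none))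

/-- Church encoding of the conditional: `λb.λt.λf. b t f`. -/
def churchIf : LC Empty :=
  .abs (.abs (.abs (.app (.app (.var (some (some none))) (.var (some none))) (.var none))))

/-- The Church numeral `0`: `λs.λz.z`. -/
def churchZero : LC Empty := .abs (.abs (.var none))

/-- The Church-numeral successor: `λn.λs.λz. s (n s z)`. -/
def churchSucc : LC Empty :=
  .abs (.abs (.abs (.app (.var (some none))
    (.app (.app (.var (some (some none))) (.var (some none))) (.var none)))))

/-- The Church-numeral predecessor: `λn.λf.λx. n (λg.λh. h (g f)) (λu.x) (λu.u)`. -/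
def churchPred : LC Empty :=
  .abs (.abs (.abs (.app (.app (.app (.var (some (some none)))
    (.abs (.abs (.app (.var none)
      (.app (.var (some none)) (.var (some (some (some none)))))))))
    (.abs (.var (some none))))
    (.abs (.var none)))))

/-- Curry's fixpoint combinator `Y = λf.(λx. f (x x))(λx. f (x x))`. -/
def curryY : LC Empty :=
  .abs (.app
    (.abs (.app (.var (some none)) (.app (.var none) (.var none))))
    (.abs (.app (.var (some none)) (.app (.var none) (.var none)))))

/-- Moving the bound variable of an extended context `Γ ,, s` to the `Option` position. -/
def deBind {Γ : PTy → Type} {s : PTy} : (Σ τ', extCtx Γ s τ') → Option (Σ τ', Γ τ')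
  | ⟨τ', Sum.inl x⟩ => some ⟨τ', x⟩
  | ⟨_, Sum.inr _⟩ => none

/-- The translation `⟦·⟧ : PCF Γ τ → LC (Σ τ', Γ τ')` of PCF into the untyped lambda
calculus: variables to variables, `app` to `app`, `abs` to `abs` (with reindexing of the
bound variable), booleans and conditionals to their Church encodings, `zero`, `succ`,
`pred` to Church-numeral combinators, and `Fix_τ t` to `app Y ⟦t⟧` with `Y` Curry's
fixpoint combinator. -/
def toLC : {Γ : PTy → Type} → {τ : PTy} → PCF Γ τ → LC (Σ τ', Γ τ')
  | _, _, .var x => .var ⟨_, x⟩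
  | _, _, .app s t => .app (toLC s) (toLC t)
  | _, _, .abs t => .abs (LC.rename deBind (toLC t))
  | _, _, .tt => wk churchTrue
  | _, _, .ff => wk churchFalse
  | _, _, .zero => wk churchZero
  | _, _, .succ => wk churchSucc
  | _, _, .pred => wk churchPred
  | _, _, .fix _ t => .app (wk curryY) (toLC t)
  | _, _, .ite _ _ => wk churchIf

namespace LC

/-- Lifting of a substitution `σ : X → LC Y` over a binder. -/
def lift {X Y : Type} (σ : X → LC Y) : Option X → LC (Option Y)
  | none => .var none
  | some x => rename some (σ x)

/-- Simultaneous substitution of untyped lambda terms. -/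
def subst : {X Y : Type} → LC X → (X → LC Y) → LC Y
  | _, _, .var x, σ => σ x
  | _, _, .app s t, σ => .app (subst s σ) (subst t σ)
  | _, _, .abs t, σ => .abs (subst t (lift σ))

end LC

namespace PCF

/-- Extension of a typed substitution `σ : ∀ u, Γ u → PCF Δ u` over a binder of type `s`:
the new variable is sent to itself and the old variables to the weakening of `σ` along
the context inclusion. -/
def extSubst {Γ Δ : PTy → Type} (σ : ∀ u, Γ u → PCF Δ u) (s : PTy) :
    ∀ u, extCtx Γ s u → PCF (extCtx Δ s) u
  | _, Sum.inl x => rename (fun _ => Sum.inl) (σ _ x)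
  | _, Sum.inr h => .var (Sum.inr h)

/-- Typed simultaneous substitution of PCF terms, defined recursively, extending
substitutions over binders by weakening and leaving the constant combinators unchanged. -/
def subst : {Γ Δ : PTy → Type} → {τ : PTy} → PCF Γ τ →
    (∀ u, Γ u → PCF Δ u) → PCF Δ τ
  | _, _, _, .var x, σ => σ _ x
  | _, _, _, .app s t, σ => .app (subst s σ) (subst t σ)
  | _, _, _, .abs t, σ => .abs (subst t (extSubst σ _))
  | _, _, _, .tt, _ => .tt
  | _, _, _, .ff, _ => .ff
  | _, _, _, .zero, _ => .zero
  | _, _, _, .succ, _ => .succ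
  | _, _, _, .pred, _ => .pred
  | _, _, _, .fix τ t, σ => .fix τ (subst t σ)
  | _, _, _, .ite ι hι, _ => .ite ι hι

end PCF

namespace LC

theorem rename_rename {X Y Z : Type} (f : X → Y) (g : Y → Z) (t : LC X) :
    rename g (rename f t) = rename (g ∘ f) t := by
  induction t generalizing Y Z with
  | var x => rfl
  | app s t ihs iht => simp only [rename, ihs, iht]
  | abs t ih => simp only [rename, ih, Option.map_comp_map]

theorem lift_var_comp {X Y : Type} (f : X → Y) :
    lift (fun x => var (f x)) = fun x => var (Option.map f x) := by
  funext x
  cases x <;> rfl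

theorem subst_var_comp {X Y : Type} (f : X → Y) (t : LC X) :
    subst t (fun x => var (f x)) = rename f t := by
  induction t generalizing Y with
  | var x => rfl
  | app s t ihs iht => simp only [subst, rename, ihs, iht]
  | abs t ih => simp only [subst, rename, lift_var_comp, ih]

theorem lift_comp_map {X Y Z : Type} (f : X → Y) (σ : Y → LC Z) :
    lift σ ∘ Option.map f = lift (σ ∘ f) := by
  funext x
  cases x <;> rfl

theorem subst_rename {X Y Z : Type} (f : X → Y) (σ : Y → LC Z) (t : LC X) :
    subst (rename f t) σ = subst t (σ ∘ f) := by
  induction t generalizing Y Z with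
  | var x => rfl
  | app s t ihs iht => simp only [subst, rename, ihs, iht]
  | abs t ih => simp only [subst, rename, ih, lift_comp_map]

theorem rename_map_comp_lift {X Y Z : Type} (f : Y → Z) (σ : X → LC Y) :
    rename (Option.map f) ∘ lift σ = lift (rename f ∘ σ) := by
  funext x
  cases x with
  | none => rfl
  | some x =>
    simp only [Function.comp_apply, lift, rename_rename]
    rfl

theorem rename_subst {X Y Z : Type} (f : Y → Z) (σ : X → LC Y) (t : LC X) :
    rename f (subst t σ) = subst t (rename f ∘ σ) := by
  induction t generalizing Y Z with
  | var x => rfl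
  | app s t ihs iht => simp only [subst, rename, ihs, iht]
  | abs t ih => simp only [subst, rename, ih, rename_map_comp_lift]

end LC

theorem rename_wk {X Y : Type} (f : X → Y) (t : LC Empty) : LC.rename f (wk t) = wk t := by
  rw [wk, wk, LC.rename_rename]
  congr 1
  exact Subsingleton.elim _ _

theorem subst_wk {X Y : Type} (σ : X → LC Y) (t : LC Empty) : LC.subst (wk t) σ = wk t := by
  rw [wk, wk, LC.subst_rename, ← LC.subst_var_comp]
  congr 1
  exact Subsingleton.elim _ _

theorem deBind_comp_map {Γ Δ : PTy → Type} (f : ∀ u, Γ u → Δ u) (s : PTy) :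
    deBind ∘ (Sigma.map id fun _ => Sum.map (f _) id :
      (Σ u, extCtx Γ s u) → Σ u, extCtx Δ s u) =
    Option.map (Sigma.map id f) ∘ deBind := by
  funext ⟨u, x⟩
  cases x <;> rfl

theorem toLC_rename {Γ Δ : PTy → Type} (f : ∀ u, Γ u → Δ u) {τ : PTy} (t : PCF Γ τ) :
    toLC (PCF.rename f t) = LC.rename (Sigma.map id f) (toLC t) := by
  induction t generalizing Δ with
  | var x => rfl
  | app s t ihs iht => simp only [PCF.rename, toLC, LC.rename, ihs, iht]
  | abs t ih =>
    refine congrArg LC.abs ((congrArg (LC.rename deBind) (ih _)).trans ?_)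
    rw [LC.rename_rename, LC.rename_rename]
    exact congrArg (fun g => LC.rename g (toLC t)) (deBind_comp_map f _)
  | fix τ t ih => simp only [PCF.rename, toLC, LC.rename, ih, rename_wk]
  | _ => simp only [PCF.rename, toLC, rename_wk]

theorem rename_deBind_toLC_extSubst {Γ Δ : PTy → Type} (σ : ∀ u, Γ u → PCF Δ u) (s : PTy)
    (p : Σ u, extCtx Γ s u) :
    LC.rename deBind (toLC (PCF.extSubst σ s p.1 p.2)) =
      LC.lift (fun q : Σ u, Γ u => toLC (σ q.1 q.2)) (deBind p) := by
  obtain ⟨u, x | h⟩ := p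
  · refine (congrArg (LC.rename deBind)
      (toLC_rename (Δ := extCtx Δ s) (fun _ => Sum.inl) (σ u x))).trans ?_
    rw [LC.rename_rename]
    rfl
  · rfl

/-- The translation of PCF into the untyped lambda calculus commutes with simultaneous
substitution: `⟦subst t σ⟧ = LC.subst ⟦t⟧ (fun ⟨u, x⟩ => ⟦σ u x⟧)`. -/
theorem toLC_subst {Γ Δ : PTy → Type} (σ : ∀ u, Γ u → PCF Δ u) {τ : PTy}
    (t : PCF Γ τ) :
    toLC (PCF.subst t σ) = LC.subst (toLC t) (fun p => toLC (σ p.1 p.2)) := by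
  induction t generalizing Δ with
  | var x => rfl
  | app s t ihs iht => simp only [PCF.subst, toLC, LC.subst, ihs, iht]
  | abs t ih =>
    simp only [PCF.subst, toLC, LC.subst, ih, LC.subst_rename, LC.rename_subst]
    congr 2
    funext p
    exact rename_deBind_toLC_extSubst σ _ p
  | fix τ t ih => simp only [PCF.subst, toLC, LC.subst, ih, subst_wk]
  | _ => simp only [PCF.subst, toLC, subst_wk]
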